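/- arXiv:1506.03397 — 3 statements merged into one kernel-verified Lean document; each statement's English description precedes it below -/
import Mathlib

section
/- Let (e_n, e_n*) be a semi-normalized bounded biorthogonal system in an infinite-dimensional Banach space X which is C-suppression quasi-greedy for some C ≥ 1. Let x ∈ X and let ρ : ℕ → ℕ be a greedy ordering for x, i.e., ρ is injective, supp(x) ⊆ ρ(ℕ), and |e_{ρ(i)}*(x)| ≥ |e_{ρ(j)}*(x)| whenever i ≤ j. Then for every non-decreasing sequence (λ_i)_{i≥1} of real numbers with 0 ≤ λ_i ≤ 1 for all i, the series ∑_{i=1}^∞ λ_i e_{ρ(i)}*(x) e_{ρ(i)} converges in X and ‖∑_{i=1}^∞ λ_i e_{ρ(i)}*(x) e_{ρ(i)}‖ ≤ C‖x‖. -/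
open Finset

variable {𝕜 X : Type*}

section Defs

variable (𝕜) [RCLike 𝕜] [NormedAddCommGroup X] [NormedSpace 𝕜 X]

/-- A semi-normalized bounded biorthogonal system: biorthogonality, totality of the span,
and a uniform bound on the norms of the vectors and the functionals. -/
def BiorthSystem (e : ℕ → X) (f : ℕ → X →L[𝕜] 𝕜) : Prop :=
  (∀ n k, f n (e k) = if n = k then (1 : 𝕜) else 0) ∧
  (Submodule.span 𝕜 (Set.range e)).topologicalClosure = ⊤ ∧
  ∃ M : ℝ, ∀ n, ‖e n‖ ≤ M ∧ ‖f n‖ ≤ M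

variable {𝕜}

/-- The projection `P_A x = ∑_{n ∈ A} e_n*(x) e_n`. -/
noncomputable def greedyProj (e : ℕ → X) (f : ℕ → X →L[𝕜] 𝕜) (A : Finset ℕ) (x : X) : X :=
  ∑ n ∈ A, f n x • e n

/-- `A` is a greedy set for `x`: the coefficients on `A` dominate those outside `A`. -/
def IsGreedySet (f : ℕ → X →L[𝕜] 𝕜) (x : X) (A : Finset ℕ) : Prop :=
  ∀ n ∈ A, ∀ k ∉ A, ‖f k x‖ ≤ ‖f n x‖

/-- The system is `C`-almost greedy. -/
def AlmostGreedyWith (e : ℕ → X) (f : ℕ → X →L[𝕜] 𝕜) (C : ℝ) : Prop :=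
  ∀ (x : X) (A : Finset ℕ), IsGreedySet f x A →
    ∀ B : Finset ℕ, B.card ≤ A.card →
      ‖x - greedyProj e f A x‖ ≤ C * ‖x - greedyProj e f B x‖

/-- The system is `C`-suppression quasi-greedy. -/
def SuppressionQuasiGreedyWith (e : ℕ → X) (f : ℕ → X →L[𝕜] 𝕜) (C : ℝ) : Prop :=
  ∀ (x : X) (A : Finset ℕ), IsGreedySet f x A →
    ‖x - greedyProj e f A x‖ ≤ C * ‖x‖

/-- The system is `K`-suppression unconditional. -/
def SuppressionUnconditionalWith (e : ℕ → X) (f : ℕ → X →L[𝕜] 𝕜) (K : ℝ) : Prop :=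
  ∀ (x : X) (A : Finset ℕ), ‖x - greedyProj e f A x‖ ≤ K * ‖x‖

/-- The system is `C`-greedy. -/
def GreedyWith (e : ℕ → X) (f : ℕ → X →L[𝕜] 𝕜) (C : ℝ) : Prop :=
  ∀ (x : X) (A : Finset ℕ), IsGreedySet f x A →
    ∀ (B : Finset ℕ), B.card = A.card → ∀ α : ℕ → 𝕜,
      ‖x - greedyProj e f A x‖ ≤ C * ‖x - ∑ n ∈ B, α n • e n‖

/-- The system is `C`-symmetric for largest coefficients; for `C = 1` this is Property (A). -/
def SymmetricLargestCoeffsWith (e : ℕ → X) (f : ℕ → X →L[𝕜] 𝕜) (C : ℝ) : Prop :=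
  ∀ (z : X) (A B : Finset ℕ), Disjoint A B → A.card = B.card →
    (∀ n ∈ A ∪ B, f n z = 0) →
    ∀ (ε θ : ℕ → 𝕜), (∀ n ∈ A, ‖ε n‖ = 1) → (∀ n ∈ B, ‖θ n‖ = 1) →
    ∀ t : 𝕜, (∀ n, ‖f n z‖ ≤ ‖t‖) →
      ‖z + t • ∑ n ∈ B, θ n • e n‖ ≤ C * ‖z + t • ∑ n ∈ A, ε n • e n‖

end Defs

variable [RCLike 𝕜] [NormedAddCommGroup X] [NormedSpace 𝕜 X] [CompleteSpace X]

lemma aux_coef (e : ℕ → X) (f : ℕ → X →L[𝕜] 𝕜)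
    (hb : ∀ n k, f n (e k) = if n = k then (1 : 𝕜) else 0) (B : Finset ℕ) (c : ℕ → 𝕜) (n : ℕ) :
    f n (∑ i ∈ B, c i • e i) = if n ∈ B then c n else 0 := by
  simp [map_sum, hb]

lemma aux_approx (e : ℕ → X) (f : ℕ → X →L[𝕜] 𝕜) (hsys : BiorthSystem 𝕜 e f) (x : X)
    (ε : ℝ) (hε : 0 < ε) :
    ∃ (B : Finset ℕ) (c : ℕ → 𝕜), ‖x - ∑ i ∈ B, c i • e i‖ < ε := by
  have hx : x ∈ closure ((Submodule.span 𝕜 (Set.range e) : Submodule 𝕜 X) : Set X) := by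
    rw [← Submodule.topologicalClosure_coe, hsys.2.1]; trivial
  obtain ⟨y, hy, hxy⟩ := Metric.mem_closure_iff.1 hx ε hε
  obtain ⟨c, rfl⟩ := Finsupp.mem_span_range_iff_exists_finsupp.1 hy
  exact ⟨c.support, c, by rwa [dist_eq_norm] at hxy⟩

lemma aux_coef_tendsto (e : ℕ → X) (f : ℕ → X →L[𝕜] 𝕜) (hsys : BiorthSystem 𝕜 e f) (x : X)
    (ρ : ℕ → ℕ) (hinj : Function.Injective ρ) :
    Filter.Tendsto (fun i => ‖f (ρ i) x‖) Filter.atTop (nhds 0) := by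
  obtain ⟨M, hM⟩ := hsys.2.2
  have hM0 : 0 ≤ M := (norm_nonneg _).trans (hM 0).1
  rw [Metric.tendsto_nhds]
  intro ε hε
  obtain ⟨B, c, hB⟩ := aux_approx e f hsys x (ε / (M + 1)) (by positivity)
  have hev : ∀ᶠ i in Filter.atTop, ρ i ∉ B := by
    have h1 := hinj.tendsto_cofinite.eventually (B.finite_toSet.eventually_cofinite_notMem)
    rw [Nat.cofinite_eq_atTop] at h1
    simpa using h1
  filter_upwards [hev] with i hi
  have h2 : f (ρ i) x = f (ρ i) (x - ∑ i ∈ B, c i • e i) := by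
    rw [map_sub, aux_coef e f hsys.1, if_neg hi, sub_zero]
  rw [Real.dist_eq, sub_zero, abs_norm, h2]
  calc _ ≤ ‖f (ρ i)‖ * ‖x - ∑ i ∈ B, c i • e i‖ := ContinuousLinearMap.le_opNorm _ _
    _ ≤ M * (ε / (M + 1)) := by gcongr; exact (hM _).2
    _ < (M + 1) * (ε / (M + 1)) := by gcongr; linarith
    _ = ε := by field_simp

lemma aux_step (e : ℕ → X) (f : ℕ → X →L[𝕜] 𝕜)
    (hb : ∀ n k, f n (e k) = if n = k then (1 : 𝕜) else 0) (M : ℝ) (hM : ∀ n, ‖e n‖ ≤ M)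
    (C : ℝ) (hC : 1 ≤ C) (hqg : SuppressionQuasiGreedyWith e f C) (x : X)
    (B : Finset ℕ) (c : ℕ → 𝕜) (A : Finset ℕ) (δ : ℝ) (hδ : 0 ≤ δ)
    (hA1 : ∀ n ∈ A, δ ≤ ‖f n x‖) (hA2 : ∀ n ∉ A, ‖f n x‖ ≤ δ)
    (hBA : ∀ n ∈ B, n ∈ A ∨ f n x = 0) :
    ‖x - ∑ n ∈ A, f n x • e n‖ ≤ C * (‖x - ∑ i ∈ B, c i • e i‖ + B.card * (2 * δ * M)) := by
  classical
  set c' : ℕ → 𝕜 := fun n => if δ ≤ ‖f n x - c n‖ then c n else f n x - (δ : 𝕜) with hc'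
  have h1 : ∀ n, δ ≤ ‖f n x - c' n‖ := by
    intro n
    by_cases h : δ ≤ ‖f n x - c n‖
    · simp only [hc', if_pos h]; exact h
    · simp only [hc', if_neg h, sub_sub_cancel]
      rw [RCLike.norm_ofReal, abs_of_nonneg hδ]
  have h2 : ∀ n, ‖c n - c' n‖ ≤ 2 * δ := by
    intro n
    by_cases h : δ ≤ ‖f n x - c n‖
    · simp only [hc', if_pos h, sub_self, norm_zero]; positivity
    · simp only [hc', if_neg h]
      have : c n - (f n x - (δ : 𝕜)) = (δ : 𝕜) - (f n x - c n) := by ring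
      rw [this]
      refine (norm_sub_le _ _).trans ?_
      rw [RCLike.norm_ofReal, abs_of_nonneg hδ]
      linarith
  set y' := ∑ i ∈ B, c' i • e i with hy'
  have hcf : ∀ n, f n (x - y') = f n x - if n ∈ B then c' n else 0 := by
    intro n
    rw [map_sub, hy', aux_coef e f hb]
  have hgr : IsGreedySet f (x - y') (A ∪ B) := by
    intro n hn k hk
    rw [Finset.mem_union, not_or] at hk
    rw [hcf, hcf, if_neg hk.2, sub_zero]
    refine (hA2 k hk.1).trans ?_
    by_cases hnB : n ∈ B
    · rw [if_pos hnB]; exact h1 n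
    · rw [if_neg hnB, sub_zero]
      exact hA1 n ((Finset.mem_union.1 hn).resolve_right hnB)
  have hP : greedyProj e f (A ∪ B) (x - y') = (∑ n ∈ A, f n x • e n) - y' := by
    unfold greedyProj
    simp only [hcf, sub_smul, Finset.sum_sub_distrib]
    congr 1
    · symm
      refine Finset.sum_subset Finset.subset_union_left ?_
      intro n hn hnA
      have hnB := (Finset.mem_union.1 hn).resolve_left hnA
      rw [(hBA n hnB).resolve_left hnA, zero_smul]
    · rw [hy', ← Finset.sum_subset (Finset.subset_union_right (s₁ := A) (s₂ := B))]
      · exact Finset.sum_congr rfl fun n hn => by rw [if_pos hn]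
      · intro n _ hn
        rw [if_neg hn, zero_smul]
  have h3 := hqg _ _ hgr
  rw [hP, sub_sub_sub_cancel_right] at h3
  refine h3.trans (mul_le_mul_of_nonneg_left ?_ (by linarith))
  have h4 : x - y' = (x - ∑ i ∈ B, c i • e i) + ∑ i ∈ B, (c i - c' i) • e i := by
    simp only [sub_smul, Finset.sum_sub_distrib, ← hy']; abel
  rw [h4]
  refine (norm_add_le _ _).trans (add_le_add le_rfl ?_)
  refine (norm_sum_le_of_le B (n := fun _ => 2 * δ * M) (fun n _ => ?_)).trans ?_
  · rw [norm_smul]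
    exact mul_le_mul (h2 n) (hM n) (norm_nonneg _) (by positivity)
  · simp

lemma aux_range (f : ℕ → X →L[𝕜] 𝕜) (x : X) (ρ : ℕ → ℕ)
    (hsupp : ∀ n, f n x ≠ 0 → n ∈ Set.range ρ)
    (hord : ∀ i j : ℕ, i ≤ j → ‖f (ρ j) x‖ ≤ ‖f (ρ i) x‖) (m : ℕ) :
    (∀ n ∈ (Finset.range m).image ρ, ‖f (ρ m) x‖ ≤ ‖f n x‖) ∧
    (∀ n ∉ (Finset.range m).image ρ, ‖f n x‖ ≤ ‖f (ρ m) x‖) := by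
  constructor
  · intro n hn
    obtain ⟨i, hi, rfl⟩ := Finset.mem_image.1 hn
    exact hord _ _ (Finset.mem_range.1 hi).le
  · intro n hn
    by_cases h : f n x = 0
    · rw [h, norm_zero]; exact norm_nonneg _
    · obtain ⟨j, rfl⟩ := hsupp n h
      refine hord _ _ ?_
      by_contra hlt
      exact hn (Finset.mem_image_of_mem _ (Finset.mem_range.2 (not_le.1 hlt)))

lemma aux_conv (e : ℕ → X) (f : ℕ → X →L[𝕜] 𝕜)
    (hsys : BiorthSystem 𝕜 e f) (C : ℝ) (hC : 1 ≤ C)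
    (hqg : SuppressionQuasiGreedyWith e f C)
    (x : X) (ρ : ℕ → ℕ) (hinj : Function.Injective ρ)
    (hsupp : ∀ n, f n x ≠ 0 → n ∈ Set.range ρ)
    (hord : ∀ i j : ℕ, i ≤ j → ‖f (ρ j) x‖ ≤ ‖f (ρ i) x‖) :
    Filter.Tendsto (fun N => x - ∑ n ∈ (Finset.range N).image ρ, f n x • e n)
      Filter.atTop (nhds 0) := by
  obtain ⟨M, hM⟩ := hsys.2.2
  rw [Metric.tendsto_nhds]
  intro ε hε
  have hC0 : 0 < C := by linarith
  obtain ⟨B, c, hB⟩ := aux_approx e f hsys x (ε / C) (by positivity)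
  have hev : ∀ᶠ m in Filter.atTop, ∀ n ∈ B, n ∈ (Finset.range m).image ρ ∨ f n x = 0 := by
    rw [Filter.eventually_all_finset]
    intro n _
    by_cases h : f n x = 0
    · exact Filter.Eventually.of_forall fun _ => Or.inr h
    · obtain ⟨j, rfl⟩ := hsupp n h
      filter_upwards [Filter.eventually_gt_atTop j] with m hm
      exact Or.inl (Finset.mem_image_of_mem _ (Finset.mem_range.2 hm))
  have hlim : Filter.Tendsto (fun m => C * (‖x - ∑ i ∈ B, c i • e i‖ +
      B.card * (2 * ‖f (ρ m) x‖ * M))) Filter.atTop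
      (nhds (C * (‖x - ∑ i ∈ B, c i • e i‖ + B.card * (2 * 0 * M)))) :=
    (((((aux_coef_tendsto e f hsys x ρ hinj).const_mul 2).mul_const M).const_mul _).const_add
      _).const_mul _
  have hlt : C * (‖x - ∑ i ∈ B, c i • e i‖ + B.card * (2 * 0 * M)) < ε := by
    have := (lt_div_iff₀' hC0).1 hB
    simpa using this
  filter_upwards [hev, hlim.eventually (gt_mem_nhds hlt)] with m h1 h2
  rw [dist_zero_right]
  obtain ⟨h3, h4⟩ := aux_range f x ρ hsupp hord m
  exact (aux_step e f hsys.1 M (fun n => (hM n).1) C hC hqg x B c _ _ (norm_nonneg _)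
    h3 h4 h1).trans_lt h2

/-- For a `C`-suppression quasi-greedy system, a greedy ordering `ρ` of `x`, and a
non-decreasing sequence of multipliers in `[0,1]`, the multiplied series converges and its
sum has norm at most `C‖x‖`. -/
theorem stmt_5 (hX : ¬ FiniteDimensional 𝕜 X) (e : ℕ → X) (f : ℕ → X →L[𝕜] 𝕜)
    (hsys : BiorthSystem 𝕜 e f) (C : ℝ) (hC : 1 ≤ C)
    (hqg : SuppressionQuasiGreedyWith e f C)
    (x : X) (ρ : ℕ → ℕ) (hinj : Function.Injective ρ)
    (hsupp : ∀ n, f n x ≠ 0 → n ∈ Set.range ρ)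
    (hord : ∀ i j : ℕ, i ≤ j → ‖f (ρ j) x‖ ≤ ‖f (ρ i) x‖)
    (l : ℕ → ℝ) (hl0 : ∀ i, 0 ≤ l i) (hl1 : ∀ i, l i ≤ 1) (hlmono : Monotone l) :
    ∃ S : X,
      Filter.Tendsto (fun N => ∑ i ∈ Finset.range N, ((l i : 𝕜) * f (ρ i) x) • e (ρ i))
        Filter.atTop (nhds S) ∧ ‖S‖ ≤ C * ‖x‖ := by
  set R : ℕ → X := fun N => x - ∑ n ∈ (Finset.range N).image ρ, f n x • e n with hR
  have hR0 : R 0 = x := by simp [hR]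
  have hRlim : Filter.Tendsto R Filter.atTop (nhds 0) :=
    aux_conv e f hsys C hC hqg x ρ hinj hsupp hord
  have hRn : ∀ N, ‖R N‖ ≤ C * ‖x‖ := by
    intro N
    obtain ⟨h3, h4⟩ := aux_range f x ρ hsupp hord N
    exact hqg x _ fun n hn k hk => (h4 k hk).trans (h3 n hn)
  have hRd : ∀ N, f (ρ N) x • e (ρ N) = R N - R (N + 1) := by
    intro N
    simp only [hR, Finset.sum_image hinj.injOn, Finset.sum_range_succ]
    abel
  set g : ℕ → X := fun i => ((l (i + 1) - l i : ℝ) : 𝕜) • R (i + 1) with hg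
  have habel : ∀ N, ∑ i ∈ Finset.range N, ((l i : 𝕜) * f (ρ i) x) • e (ρ i)
      = (l 0 : 𝕜) • x + ∑ i ∈ Finset.range N, g i - (l N : 𝕜) • R N := by
    intro N
    induction N with
    | zero => simp [hR0]
    | succ N ih =>
      rw [Finset.sum_range_succ, Finset.sum_range_succ, ih, mul_smul, hRd]
      simp only [hg, RCLike.ofReal_sub, sub_smul, smul_sub]
      abel
  have hgn : ∀ i, ‖g i‖ ≤ (l (i + 1) - l i) * (C * ‖x‖) := by
    intro i
    have h0 : 0 ≤ l (i + 1) - l i := sub_nonneg.2 (hlmono (Nat.le_succ i))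
    simp only [hg]
    rw [norm_smul, RCLike.norm_ofReal, abs_of_nonneg h0]
    exact mul_le_mul_of_nonneg_left (hRn _) h0
  have hCx : 0 ≤ C * ‖x‖ := by positivity
  have hsum : ∀ N, ∑ i ∈ Finset.range N, ‖g i‖ ≤ (l N - l 0) * (C * ‖x‖) := by
    intro N
    refine (Finset.sum_le_sum fun i _ => hgn i).trans ?_
    rw [← Finset.sum_mul, Finset.sum_range_sub]
  have hsm : Summable g := by
    refine Summable.of_norm (summable_of_sum_range_le (c := C * ‖x‖) (fun _ => norm_nonneg _) ?_)
    intro N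
    refine (hsum N).trans ?_
    have h1 := hl1 N
    have h2 := hl0 0
    exact mul_le_of_le_one_left hCx (by linarith)
  have hlim1 : Filter.Tendsto (fun N => (l 0 : 𝕜) • x + ∑ i ∈ Finset.range N, g i)
      Filter.atTop (nhds ((l 0 : 𝕜) • x + ∑' i, g i)) :=
    hsm.hasSum.tendsto_sum_nat.const_add _
  have hlim2 : Filter.Tendsto (fun N => (l N : 𝕜) • R N) Filter.atTop (nhds 0) := by
    refine squeeze_zero_norm (a := fun N => ‖R N‖) (fun N => ?_) (by simpa using hRlim.norm)
    rw [norm_smul, RCLike.norm_ofReal, abs_of_nonneg (hl0 N)]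
    exact mul_le_of_le_one_left (norm_nonneg _) (hl1 N)
  refine ⟨(l 0 : 𝕜) • x + ∑' i, g i, ?_, ?_⟩
  · simp only [habel]
    simpa using hlim1.sub hlim2
  · refine le_of_tendsto hlim1.norm (Filter.Eventually.of_forall fun N => ?_)
    refine (norm_add_le _ _).trans ?_
    have h1 : ‖(l 0 : 𝕜) • x‖ ≤ l 0 * (C * ‖x‖) := by
      rw [norm_smul, RCLike.norm_ofReal, abs_of_nonneg (hl0 0)]
      have h0 := hRn 0
      rw [hR0] at h0
      exact mul_le_mul_of_nonneg_left h0 (hl0 0)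
    have h2 := (norm_sum_le (Finset.range N) g).trans (hsum N)
    have h3 : l N * (C * ‖x‖) ≤ C * ‖x‖ := mul_le_of_le_one_left hCx (hl1 N)
    nlinarith
end

section
/- Let (e_n, e_n*) be a semi-normalized bounded biorthogonal system in an infinite-dimensional Banach space X which is C-symmetric for largest coefficients for some C ≥ 1. Then for every x ∈ X, all finite sets A, B ⊆ ℕ with |A| ≤ |B| and B ∩ supp(x) = ∅, all scalars (ε_n)_{n∈B} of modulus 1, and every real number t ≥ 0 with |e_n*(x)| ≤ t for all n ∈ ℕ, one has ‖x‖ ≤ C ‖x − P_A(x) + t ∑_{n∈B} ε_n e_n‖. -/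
open Finset

variable {𝕜 X : Type*}

variable [RCLike 𝕜] [NormedAddCommGroup X] [NormedSpace 𝕜 X] [CompleteSpace X]

theorem aux_polar {𝕜 : Type*} [RCLike 𝕜] (a : 𝕜) (t : ℝ) (ha : ‖a‖ ≤ t) :
    ∃ (u : 𝕜) (m : ℝ), ‖u‖ = 1 ∧ 0 ≤ m ∧ m ≤ 1 ∧ a = (m : 𝕜) * ((t : 𝕜) * u) := by
  by_cases h : a = 0
  · exact ⟨1, 0, by simp, le_rfl, zero_le_one, by simp [h]⟩
  · have hp : 0 < ‖a‖ := norm_pos_iff.mpr h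
    have htp : 0 < t := hp.trans_le ha
    have h1 : ((‖a‖ : ℝ) : 𝕜) ≠ 0 := by exact_mod_cast hp.ne'
    have h2 : (t : 𝕜) ≠ 0 := by exact_mod_cast htp.ne'
    refine ⟨a / (‖a‖ : ℝ), ‖a‖ / t, ?_, by positivity, (div_le_one htp).2 ha, ?_⟩
    · rw [norm_div, RCLike.norm_ofReal, abs_of_pos hp, div_self hp.ne']
    · push_cast
      field_simp

theorem aux_convex {𝕜 X : Type*} [RCLike 𝕜] [NormedAddCommGroup X] [NormedSpace 𝕜 X]
    (e : ℕ → X) (a : ℕ → 𝕜) (t : ℝ) (ha : ∀ n, ‖a n‖ ≤ t) (R : ℝ) (E : Finset ℕ) :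
    ∀ z : X, (∀ η : ℕ → 𝕜, (∀ n, ‖η n‖ = 1) → ‖z + (t : 𝕜) • ∑ n ∈ E, η n • e n‖ ≤ R) →
      ‖z + ∑ n ∈ E, a n • e n‖ ≤ R := by
  induction E using Finset.induction_on with
  | empty => 
    intro z h
    simpa using h (fun _ => 1) (by simp)
  | insert m E hm ih =>
    intro z h
    rw [Finset.sum_insert hm, ← add_assoc]
    apply ih
    intro η hη
    obtain ⟨u, μ, hu, h0, h1, hau⟩ := aux_polar (a m) t (ha m)
    have key : ∀ v : 𝕜, ‖v‖ = 1 →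
        ‖z + ((t : 𝕜) * v) • e m + (t : 𝕜) • ∑ n ∈ E, η n • e n‖ ≤ R := by
      intro v hv
      have := h (Function.update η m v) (by
        intro n
        by_cases hn : n = m
        · subst hn; simpa using hv
        · simpa [hn] using hη n)
      rw [Finset.sum_insert hm] at this
      have hs : ∑ n ∈ E, Function.update η m v n • e n = ∑ n ∈ E, η n • e n := by
        apply Finset.sum_congr rfl
        intro n hn
        have : n ≠ m := fun h => hm (h ▸ hn)
        simp [this]
      rw [hs, Function.update_self, smul_add, smul_smul, ← add_assoc] at this
      exact this
    have k1 := key u hu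
    have k2 := key (-u) (by simpa using hu)
    set S := (t : 𝕜) • ∑ n ∈ E, η n • e n
    have hid : z + a m • e m + S =
        (((1 + μ) / 2 : ℝ) : 𝕜) • (z + ((t : 𝕜) * u) • e m + S) +
        (((1 - μ) / 2 : ℝ) : 𝕜) • (z + ((t : 𝕜) * (-u)) • e m + S) := by
      rw [hau]
      push_cast
      module
    rw [hid]
    refine (norm_add_le _ _).trans ?_
    rw [norm_smul, norm_smul, RCLike.norm_ofReal, RCLike.norm_ofReal,
      abs_of_nonneg (by linarith), abs_of_nonneg (by linarith)]
    nlinarith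

theorem aux_tendsto {𝕜 X : Type*} [RCLike 𝕜] [NormedAddCommGroup X] [NormedSpace 𝕜 X]
    (e : ℕ → X) (f : ℕ → X →L[𝕜] 𝕜) (hsys : BiorthSystem 𝕜 e f) (x : X) (δ : ℝ) (hδ : 0 < δ) :
    ∃ N, ∀ n, N ≤ n → ‖f n x‖ < δ := by
  obtain ⟨hb, hd, M, hM⟩ := hsys
  have hM0 : 0 ≤ M := (norm_nonneg _).trans (hM 0).1
  have hfin : ∀ y ∈ Submodule.span 𝕜 (Set.range e), ∃ N, ∀ n, N ≤ n → f n y = 0 := by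
    intro y hy
    induction hy using Submodule.span_induction with
    | mem y hy =>
      obtain ⟨k, rfl⟩ := hy
      refine ⟨k + 1, fun n hn => ?_⟩
      rw [hb, if_neg (by omega)]
    | zero => exact ⟨0, by simp⟩
    | add y z _ _ h1 h2 =>
      obtain ⟨N, hN⟩ := h1
      obtain ⟨K, hK⟩ := h2
      refine ⟨max N K, fun n hn => ?_⟩
      rw [map_add, hN n (le_trans (le_max_left _ _) hn), hK n (le_trans (le_max_right _ _) hn),
        add_zero]
    | smul c y _ h1 =>
      obtain ⟨N, hN⟩ := h1
      refine ⟨N, fun n hn => ?_⟩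
      rw [map_smul, hN n hn, smul_zero]
  have hx : x ∈ closure (Submodule.span 𝕜 (Set.range e) : Set X) := by
    rw [← Submodule.topologicalClosure_coe, hd]; trivial
  obtain ⟨y, hy, hxy⟩ := Metric.mem_closure_iff.mp hx (δ / (M + 1)) (by positivity)
  obtain ⟨N, hN⟩ := hfin y hy
  refine ⟨N, fun n hn => ?_⟩
  have h1 : f n x = f n (x - y) := by rw [map_sub, hN n hn, sub_zero]
  rw [h1]
  rw [dist_eq_norm, lt_div_iff₀ (by positivity)] at hxy
  have h2 := (f n).le_opNorm (x - y)
  have h3 := mul_le_mul_of_nonneg_right (hM n).2 (norm_nonneg (x - y))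
  have h4 := norm_nonneg (x - y)
  by_cases h5 : ‖x - y‖ = 0
  · rw [h5] at h2; simp only [mul_zero] at h2; linarith
  · have : 0 < ‖x - y‖ := lt_of_le_of_ne h4 (Ne.symm h5)
    nlinarith

theorem aux_eq {𝕜 X : Type*} [RCLike 𝕜] [NormedAddCommGroup X] [NormedSpace 𝕜 X]
    (e : ℕ → X) (f : ℕ → X →L[𝕜] 𝕜)
    (hsys : BiorthSystem 𝕜 e f) (C : ℝ)
    (hslc : SymmetricLargestCoeffsWith e f C)
    (x : X) (E B : Finset ℕ) (hcard : E.card = B.card) (hdis : Disjoint B E)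
    (hB : ∀ n ∈ B, f n x = 0)
    (ε : ℕ → 𝕜) (hε : ∀ n ∈ B, ‖ε n‖ = 1)
    (t : ℝ) (ht : 0 ≤ t) (hbound : ∀ n, ‖f n x‖ ≤ t) :
    ‖x‖ ≤ C * ‖x - greedyProj e f E x + (t : 𝕜) • ∑ n ∈ B, ε n • e n‖ := by
  have hz : ∀ n, f n (x - greedyProj e f E x) = if n ∈ E then 0 else f n x := by
    intro n
    simp only [greedyProj, map_sub, map_sum, map_smul, hsys.1, smul_eq_mul, mul_ite, mul_one,
      mul_zero, Finset.sum_ite_eq]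
    split_ifs <;> simp
  have h := aux_convex e (fun n => f n x) t hbound
    (C * ‖x - greedyProj e f E x + (t : 𝕜) • ∑ n ∈ B, ε n • e n‖) E (x - greedyProj e f E x) ?_
  · have : x - greedyProj e f E x + ∑ n ∈ E, f n x • e n = x := by
      simp [greedyProj]
    rwa [this] at h
  · intro η hη
    apply hslc _ B E hdis hcard.symm _ ε η hε (fun n _ => hη n)
    · intro n
      rw [hz, RCLike.norm_ofReal, abs_of_nonneg ht]
      split_ifs
      · simpa using ht
      · exact hbound n
    · intro n hn
      rw [hz]
      split_ifs with hnE
      · rfl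
      · rcases Finset.mem_union.mp hn with h | h
        · exact hB n h
        · exact absurd h hnE

/-- Re-formulation of symmetry for largest coefficients: if `|A| ≤ |B|`, `B` is disjoint from
the support of `x`, and `t` dominates all coefficients of `x`, then
`‖x‖ ≤ C ‖x - P_A(x) + t ∑_{n ∈ B} ε_n e_n‖`. -/
theorem stmt_6 (hX : ¬ FiniteDimensional 𝕜 X) (e : ℕ → X) (f : ℕ → X →L[𝕜] 𝕜)
    (hsys : BiorthSystem 𝕜 e f) (C : ℝ) (hC : 1 ≤ C)
    (hslc : SymmetricLargestCoeffsWith e f C)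
    (x : X) (A B : Finset ℕ) (hcard : A.card ≤ B.card)
    (hB : ∀ n ∈ B, f n x = 0)
    (ε : ℕ → 𝕜) (hε : ∀ n ∈ B, ‖ε n‖ = 1)
    (t : ℝ) (ht : 0 ≤ t) (hbound : ∀ n, ‖f n x‖ ≤ t) :
    ‖x‖ ≤ C * ‖x - greedyProj e f A x + (t : 𝕜) • ∑ n ∈ B, ε n • e n‖ := by
  have hfun := aux_tendsto e f hsys x
  obtain ⟨M, hM⟩ := hsys.2.2
  have hM0 : 0 ≤ M := (norm_nonneg _).trans (hM 0).1
  apply le_of_forall_pos_le_add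
  intro r hr
  have hC0 : 0 < C := by linarith
  set k := B.card - (A \ B).card
  have hk : (A \ B).card ≤ B.card := (Finset.card_le_card Finset.sdiff_subset).trans hcard
  set δ : ℝ := r / (C * (k + 1) * (M + 1))
  have hδ : 0 < δ := by positivity
  obtain ⟨N, hN⟩ := hfun δ hδ
  have hinf : (Set.Ici N \ ((A ∪ B : Finset ℕ) : Set ℕ)).Infinite :=
    (Set.Ici_infinite N).sdiff (Finset.finite_toSet _)
  obtain ⟨D, hD, hDc⟩ := hinf.exists_subset_card_eq k
  have hDN : ∀ n ∈ D, N ≤ n ∧ n ∉ A ∧ n ∉ B := by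
    intro n hn
    have := hD hn
    simpa using this
  have hdis : Disjoint (A \ B) D := by
    rw [Finset.disjoint_left]
    intro n hn hn'
    exact (hDN n hn').2.1 (Finset.mem_sdiff.mp hn).1
  have hmain := aux_eq e f hsys C hslc x ((A \ B) ∪ D) B
    (by rw [Finset.card_union_of_disjoint hdis, hDc]; omega)
    (by
      rw [Finset.disjoint_left]
      intro n hn hn'
      rcases Finset.mem_union.mp hn' with h | h
      · exact (Finset.mem_sdiff.mp h).2 hn
      · exact (hDN n h).2.2 hn) hB ε hε t ht hbound
  have hproj : greedyProj e f ((A \ B) ∪ D) x = greedyProj e f A x + greedyProj e f D x := by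
    unfold greedyProj
    rw [Finset.sum_union hdis]
    congr 1
    apply Finset.sum_subset Finset.sdiff_subset
    intro n hn hn'
    have : n ∈ B := by
      by_contra h
      exact hn' (Finset.mem_sdiff.mpr ⟨hn, h⟩)
    rw [hB n this, zero_smul]
  have hsmall : ‖greedyProj e f D x‖ ≤ k * (δ * M) := by
    unfold greedyProj
    rw [← hDc, ← nsmul_eq_mul]
    apply (norm_sum_le _ _).trans
    apply Finset.sum_le_card_nsmul
    intro n hn
    rw [norm_smul]
    exact mul_le_mul (hN n (hDN n hn).1).le (hM n).1 (norm_nonneg _) hδ.le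
  have hCr : C * (k * (δ * M)) ≤ r := by
    have h1 : C * (k + 1) * (M + 1) * δ = r := by
      simp only [δ]
      field_simp
    have h2 : (k : ℝ) * M ≤ (k + 1) * (M + 1) := by
      have : (0 : ℝ) ≤ k := Nat.cast_nonneg k
      nlinarith
    have h3 := mul_le_mul_of_nonneg_left h2 (mul_pos hC0 hδ).le
    nlinarith
  rw [hproj] at hmain
  set S := (t : 𝕜) • ∑ n ∈ B, ε n • e n
  have h4 : x - (greedyProj e f A x + greedyProj e f D x) + S
      = (x - greedyProj e f A x + S) - greedyProj e f D x := by abel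
  rw [h4] at hmain
  have h5 := norm_sub_le (x - greedyProj e f A x + S) (greedyProj e f D x)
  have h6 := mul_le_mul_of_nonneg_left (h5.trans (add_le_add_right hsmall _)) hC0.le
  linarith
end

section
/- Let (e_n, e_n*) be a semi-normalized bounded biorthogonal system in an infinite-dimensional Banach space X. Then the system is 1-greedy if and only if it is 1-almost greedy and quasi-greedy with constant 1, the latter meaning that ‖P_A(x)‖ ≤ ‖x‖ and ‖x − P_A(x)‖ ≤ ‖x‖ for every x ∈ X and every greedy set A for x. -/
open Finset

variable {𝕜 X : Type*}

variable [RCLike 𝕜] [NormedAddCommGroup X] [NormedSpace 𝕜 X] [CompleteSpace X]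

section Helpers

variable {𝕜 X : Type*} [RCLike 𝕜] [NormedAddCommGroup X] [NormedSpace 𝕜 X]

theorem coef_sum {e : ℕ → X} {f : ℕ → X →L[𝕜] 𝕜}
    (hb : ∀ n k, f n (e k) = if n = k then (1 : 𝕜) else 0) (S : Finset ℕ) (c : ℕ → 𝕜) (n : ℕ) :
    f n (∑ k ∈ S, c k • e k) = if n ∈ S then c n else 0 := by
  simp [map_sum, hb]

theorem dense_ind {e : ℕ → X} {f : ℕ → X →L[𝕜] 𝕜} (hsys : BiorthSystem 𝕜 e f)
    {p : X → Prop} (hc : IsClosed {x | p x})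
    (h : ∀ (S : Finset ℕ) (c : ℕ → 𝕜), p (∑ n ∈ S, c n • e n)) (x : X) : p x := by
  have hx : x ∈ (Submodule.span 𝕜 (Set.range e)).topologicalClosure := by
    rw [hsys.2.1]; trivial
  have hx' : x ∈ closure (Submodule.span 𝕜 (Set.range e) : Set X) := hx
  refine closure_minimal (t := {x | p x}) ?_ hc hx'
  intro v hv
  obtain ⟨c, rfl⟩ := Finsupp.mem_span_range_iff_exists_finsupp.1 hv
  exact h c.support c

theorem continuous_proj (e : ℕ → X) (f : ℕ → X →L[𝕜] 𝕜) (A : Finset ℕ) :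
    Continuous (greedyProj e f A) := by
  unfold greedyProj
  fun_prop

theorem supp_of_single {e : ℕ → X} {f : ℕ → X →L[𝕜] 𝕜}
    (hb : ∀ n k, f n (e k) = if n = k then (1 : 𝕜) else 0)
    (h : ∀ x k, ‖x - f k x • e k‖ ≤ ‖x‖) (x : X) (A : Finset ℕ) :
    ‖x - greedyProj e f A x‖ ≤ ‖x‖ := by
  induction A using Finset.induction_on with
  | empty => simp [greedyProj]
  | insert k A hk ih =>
    refine le_trans (le_of_eq ?_) ((h (x - greedyProj e f A x) k).trans ih)
    congr 1
    have : f k (greedyProj e f A x) = 0 := by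
      unfold greedyProj
      rw [coef_sum hb A (fun n => f n x) k, if_neg hk]
    rw [map_sub, this, greedyProj, Finset.sum_insert hk, greedyProj]
    simp only [sub_zero]
    abel

theorem exists_delta (S : Finset ℕ) (c : ℕ → 𝕜) (h : ∀ n ∈ S, c n ≠ 0) :
    ∃ δ : ℝ, 0 < δ ∧ ∀ n ∈ S, δ ≤ ‖c n‖ := by
  induction S using Finset.induction_on with
  | empty => exact ⟨1, one_pos, by simp⟩
  | insert k A hk ih =>
    obtain ⟨δ, hδ, h1⟩ := ih fun n hn => h n (Finset.mem_insert_of_mem hn)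
    refine ⟨min δ ‖c k‖, lt_min hδ (norm_pos_iff.2 (h k (Finset.mem_insert_self _ _))), ?_⟩
    intro n hn
    rcases Finset.mem_insert.1 hn with rfl | hn
    · exact min_le_right _ _
    · exact (min_le_left _ _).trans (h1 n hn)

/-- The convexity argument: greedy projections being contractive gives, for finitely supported
vectors, that adding a coordinate never decreases the norm. -/
theorem local_step {e : ℕ → X} {f : ℕ → X →L[𝕜] 𝕜}
    (hb : ∀ n k, f n (e k) = if n = k then (1 : 𝕜) else 0)
    (h : ∀ (x : X) (A : Finset ℕ), IsGreedySet f x A → ‖greedyProj e f A x‖ ≤ ‖x‖)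
    (S : Finset ℕ) (c : ℕ → 𝕜) (hc : ∀ n ∈ S, c n ≠ 0) (k : ℕ) (hk : k ∉ S) (t : 𝕜) :
    ‖∑ n ∈ S, c n • e n‖ ≤ ‖∑ n ∈ S, c n • e n + t • e k‖ := by
  obtain ⟨δ, hδ, h1⟩ := exists_delta S c hc
  set y := ∑ n ∈ S, c n • e n with hy
  have hfy : ∀ n, f n y = if n ∈ S then c n else 0 := coef_sum hb S c
  set s : ℝ := min 1 (δ / (‖t‖ + 1)) with hs
  have ht : 0 < ‖t‖ + 1 := by positivity
  have hs0 : 0 < s := lt_min one_pos (by positivity)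
  have hs1 : s ≤ 1 := min_le_left _ _
  have hst : s * ‖t‖ ≤ δ := by
    have h2 : s * (‖t‖ + 1) ≤ δ := (le_div_iff₀ ht).1 (min_le_right _ _)
    nlinarith
  have hfx : ∀ n, f n (y + ((s : 𝕜) * t) • e k) =
      (if n ∈ S then c n else 0) + (if n = k then (s : 𝕜) * t else 0) := by
    intro n
    rw [map_add, hfy, map_smul, hb]
    simp
  have hfS : ∀ n ∈ S, f n (y + ((s : 𝕜) * t) • e k) = c n := by
    intro n hn
    have : n ≠ k := fun h => hk (h ▸ hn)
    rw [hfx, if_pos hn, if_neg this, add_zero]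
  have key : ‖y‖ ≤ ‖y + ((s : 𝕜) * t) • e k‖ := by
    have hg := h (y + ((s : 𝕜) * t) • e k) S ?_
    · have : greedyProj e f S (y + ((s : 𝕜) * t) • e k) = y := by
        unfold greedyProj
        exact Finset.sum_congr rfl fun n hn => by rw [hfS n hn]
      rwa [this] at hg
    · intro n hn m hm
      rw [hfS n hn, hfx, if_neg hm, zero_add]
      refine le_trans ?_ (h1 n hn)
      split_ifs
      · rw [norm_mul, RCLike.norm_ofReal, abs_of_pos hs0]; exact hst
      · simpa using hδ.le
  have heq : y + ((s : 𝕜) * t) • e k = ((1 - s : ℝ) : 𝕜) • y + (s : 𝕜) • (y + t • e k) := by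
    push_cast
    module
  have h3 : ‖y + ((s : 𝕜) * t) • e k‖ ≤ (1 - s) * ‖y‖ + s * ‖y + t • e k‖ := by
    rw [heq]
    refine (norm_add_le _ _).trans (le_of_eq ?_)
    rw [norm_smul, norm_smul, RCLike.norm_ofReal, RCLike.norm_ofReal, abs_of_pos hs0,
      abs_of_nonneg (by linarith)]
  have h4 : s * ‖y‖ ≤ s * ‖y + t • e k‖ := by nlinarith
  exact le_of_mul_le_mul_left h4 hs0

theorem single_of_greedy {e : ℕ → X} {f : ℕ → X →L[𝕜] 𝕜} (hsys : BiorthSystem 𝕜 e f)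
    (h : ∀ (x : X) (A : Finset ℕ), IsGreedySet f x A → ‖greedyProj e f A x‖ ≤ ‖x‖)
    (x : X) (k : ℕ) : ‖x - f k x • e k‖ ≤ ‖x‖ := by
  have hb := hsys.1
  refine dense_ind hsys (p := fun x => ‖x - f k x • e k‖ ≤ ‖x‖)
    (isClosed_le (by fun_prop) (by fun_prop)) ?_ x
  intro S c
  have h1 : ∑ n ∈ (S.erase k).filter (fun n => c n ≠ 0), c n • e n
      = ∑ n ∈ S.erase k, c n • e n :=
    Finset.sum_filter_of_ne fun n _ hn h0 => hn (by simp [h0])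
  have h2 : ∑ n ∈ S, c n • e n
      = ∑ n ∈ S.erase k, c n • e n + (f k (∑ n ∈ S, c n • e n)) • e k := by
    rw [coef_sum hb]
    split_ifs with hk
    · rw [Finset.sum_erase_add _ _ hk]
    · rw [Finset.erase_eq_of_notMem hk]; simp
  have h3 := local_step hb h ((S.erase k).filter (fun n => c n ≠ 0)) c (by simp) k (by simp)
    (f k (∑ n ∈ S, c n • e n))
  rw [h1, ← h2] at h3
  rwa [sub_eq_of_eq_add h2]

theorem supp_of_greedy {e : ℕ → X} {f : ℕ → X →L[𝕜] 𝕜} (hsys : BiorthSystem 𝕜 e f)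
    (h : GreedyWith e f 1) (x : X) (A : Finset ℕ) : ‖x - greedyProj e f A x‖ ≤ ‖x‖ := by
  obtain ⟨hb, -, M, hM⟩ := hsys
  have hM0 : 0 ≤ M := (norm_nonneg _).trans (hM 0).1
  set t : 𝕜 := ((M * ‖x‖ : ℝ) : 𝕜) with ht
  set y := x + ∑ n ∈ A, (t - f n x) • e n with hy
  have hfy : ∀ n, f n y = if n ∈ A then t else f n x := by
    intro n
    rw [hy, map_add, coef_sum hb A (fun n => t - f n x) n]
    split_ifs <;> simp
  have hg : IsGreedySet f y A := by
    intro n hn k hk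
    rw [hfy, hfy, if_pos hn, if_neg hk, ht, RCLike.norm_ofReal, abs_of_nonneg (by positivity)]
    exact ((f k).le_opNorm x).trans
      (mul_le_mul_of_nonneg_right (hM k).2 (norm_nonneg _))
  have h1 := h y A hg A rfl (fun n => t - f n x)
  have h2 : y - greedyProj e f A y = x - greedyProj e f A x := by
    have : greedyProj e f A y = ∑ n ∈ A, t • e n :=
      Finset.sum_congr rfl fun n hn => by rw [hfy, if_pos hn]
    rw [this, hy]
    simp only [sub_smul, Finset.sum_sub_distrib, greedyProj]
    abel
  rw [h2, hy, add_sub_cancel_right, one_mul] at h1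
  exact h1

theorem proj_of_supp {e : ℕ → X} {f : ℕ → X →L[𝕜] 𝕜} (hsys : BiorthSystem 𝕜 e f)
    (h : ∀ (x : X) (A : Finset ℕ), ‖x - greedyProj e f A x‖ ≤ ‖x‖) (x : X) (A : Finset ℕ) :
    ‖greedyProj e f A x‖ ≤ ‖x‖ := by
  refine dense_ind hsys (p := fun x => ‖greedyProj e f A x‖ ≤ ‖x‖)
    (isClosed_le (continuous_proj e f A).norm continuous_norm) ?_ x
  intro S c
  refine le_trans (le_of_eq ?_) (h _ (S \ A))
  congr 1
  have hb := hsys.1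
  set v := ∑ n ∈ S, c n • e n with hv
  have hfv : ∀ n, f n v = if n ∈ S then c n else 0 := coef_sum hb S c
  have h1 : v = greedyProj e f (S ∪ A) v := by
    have : greedyProj e f S v = greedyProj e f (S ∪ A) v := by
      refine Finset.sum_subset Finset.subset_union_left ?_
      intro n _ hn
      rw [hfv, if_neg hn, zero_smul]
    rw [← this]
    exact Finset.sum_congr rfl fun n hn => by rw [hfv, if_pos hn]
  have h2 : greedyProj e f (S ∪ A) v = greedyProj e f (S \ A) v + greedyProj e f A v := by
    unfold greedyProj
    rw [← Finset.sum_union Finset.sdiff_disjoint, Finset.sdiff_union_self_eq_union]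
  exact (sub_eq_of_eq_add' (h1.trans h2)).symm

theorem almost_of_greedy {e : ℕ → X} {f : ℕ → X →L[𝕜] 𝕜} (hsys : BiorthSystem 𝕜 e f)
    (h : GreedyWith e f 1) : AlmostGreedyWith e f 1 := by
  intro x A hA B hB
  obtain ⟨B', hBB, hcard⟩ := Infinite.exists_superset_card_eq B A.card hB
  refine (h x A hA B' hcard (fun n => f n x)).trans ?_
  rw [one_mul, one_mul]
  refine le_trans (le_of_eq ?_) (supp_of_greedy hsys h (x - greedyProj e f B x) (B' \ B))
  congr 1
  have h1 : greedyProj e f (B' \ B) (x - greedyProj e f B x) = ∑ n ∈ B' \ B, f n x • e n := by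
    refine Finset.sum_congr rfl fun n hn => ?_
    have : f n (greedyProj e f B x) = 0 := by
      unfold greedyProj
      rw [coef_sum hsys.1 B (fun n => f n x) n, if_neg (Finset.mem_sdiff.1 hn).2]
    rw [map_sub, this, sub_zero]
  rw [h1, ← Finset.sum_sdiff hBB, greedyProj]
  abel

end Helpers

/-- A system is `1`-greedy if and only if it is `1`-almost greedy and quasi-greedy with
constant `1`. -/
theorem stmt_8 (hX : ¬ FiniteDimensional 𝕜 X) (e : ℕ → X) (f : ℕ → X →L[𝕜] 𝕜)
    (hsys : BiorthSystem 𝕜 e f) :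
    GreedyWith e f 1 ↔
      (AlmostGreedyWith e f 1 ∧
        ∀ (x : X) (A : Finset ℕ), IsGreedySet f x A →
          ‖greedyProj e f A x‖ ≤ ‖x‖ ∧ ‖x - greedyProj e f A x‖ ≤ ‖x‖) := by
  constructor
  · intro h
    refine ⟨almost_of_greedy hsys h, fun x A _ => ⟨?_, supp_of_greedy hsys h x A⟩⟩
    exact proj_of_supp hsys (supp_of_greedy hsys h) x A
  · rintro ⟨hag, hq⟩ x A hA B hB α
    have hs := supp_of_single hsys.1 (single_of_greedy hsys fun x A hA => (hq x A hA).1)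
    refine (hag x A hA B hB.le).trans ?_
    rw [one_mul, one_mul]
    refine le_trans (le_of_eq ?_) (hs (x - ∑ n ∈ B, α n • e n) B)
    congr 1
    have : greedyProj e f B (x - ∑ n ∈ B, α n • e n)
        = greedyProj e f B x - ∑ n ∈ B, α n • e n := by
      unfold greedyProj
      rw [← Finset.sum_sub_distrib]
      refine Finset.sum_congr rfl fun n hn => ?_
      rw [map_sub, coef_sum hsys.1, if_pos hn, sub_smul]
    rw [this]
    abel
end
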